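/- For every integer k ≥ 3 and every δ > 0 there exist ε, β > 0 such that the following holds for all sufficiently large n: for every A ⊆ {1,...,n} with |A| ≥ δn and every β-bounded colouring χ of A, the number of pairs (a,d) with d ≥ 1 such that {a, a+d, ..., a+(k-1)d} ⊆ A and χ is injective on {a, a+d, ..., a+(k-1)d} is at least ε n². -/

import Mathlib

/-- `A` contains the `k`-term arithmetic progression with first term `a` and
common difference `d ≥ 1`. -/
def APIn (k : ℕ) (A : Finset ℕ) (a d : ℕ) : Prop :=
  1 ≤ d ∧ ∀ i < k, a + i * d ∈ A

/-- The colouring `χ` is constant on the `k`-AP with first term `a` and difference `d`. -/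
def MonoOn (k : ℕ) (χ : ℕ → ℕ) (a d : ℕ) : Prop :=
  ∀ i < k, ∀ j < k, χ (a + i * d) = χ (a + j * d)

/-- The colouring `χ` is injective (rainbow) on the `k`-AP with first term `a`
and difference `d`. -/
def RainbowOn (k : ℕ) (χ : ℕ → ℕ) (a d : ℕ) : Prop :=
  ∀ i < k, ∀ j < k, i ≠ j → χ (a + i * d) ≠ χ (a + j * d)

/-- The colouring `χ` of `A` is `β`-bounded: every colour class has size at most `β|A|`. -/
def BddColoring (β : ℝ) (A : Finset ℕ) (χ : ℕ → ℕ) : Prop :=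
  ∀ i : ℕ, ((A.filter fun a => χ a = i).card : ℝ) ≤ β * A.card

namespace RainbowAP

open Combinatorics Finset
open scoped BigOperators

section Subspaces

variable {α η ζ ι κ : Type}

/-- Composition of combinatorial subspaces. -/
def subComp (V : Subspace η α ι) (W : Subspace ζ α η) : Subspace ζ α ι where
  idxFun i := (V.idxFun i).elim Sum.inl W.idxFun
  proper e := by
    obtain ⟨j, hj⟩ := W.proper e
    obtain ⟨i, hi⟩ := V.proper j
    exact ⟨i, by simp [hi, hj]⟩

lemma subComp_apply (V : Subspace η α ι) (W : Subspace ζ α η) (x : ζ → α) :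
    subComp V W x = V (W x) := by
  ext i
  cases h : V.idxFun i <;> simp [subComp, Subspace.coe_apply, h]

/-- The extension of a subspace over `α` to one over `Option α`. -/
def liftSub (V : Subspace η α ι) : Subspace η (Option α) ι where
  idxFun i := (V.idxFun i).map some id
  proper e := by
    obtain ⟨i, hi⟩ := V.proper e
    exact ⟨i, by simp [hi]⟩

/-- Replace every `none` in a word by the letter `a`. -/
def fill (a : α) (x : ι → Option α) : ι → α := fun i => (x i).getD a

lemma fill_liftSub (V : Subspace η α ι) (a : α) (x : η → Option α) :
    fill a (liftSub V x) = V (fill a x) := by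
  ext i
  cases h : V.idxFun i <;> simp [liftSub, fill, Subspace.coe_apply, h]

lemma exists_liftSub_eq_none (V : Subspace η α ι) {x : η → Option α} (hx : ∃ e, x e = none) :
    ∃ i, liftSub V x i = none := by
  obtain ⟨e, he⟩ := hx
  obtain ⟨i, hi⟩ := V.proper e
  exact ⟨i, by simp [liftSub, Subspace.coe_apply, hi, he]⟩

/-- The line over `Option α` whose points are obtained from `x` by replacing `none`. -/
def pointLine (x : ι → Option α) (hx : ∃ i, x i = none) : Line (Option α) ι where
  idxFun i := (x i).map some
  proper := hx.imp fun i hi => by simp [hi]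

lemma pointLine_none (x : ι → Option α) (hx : ∃ i, x i = none) : pointLine x hx none = x := by
  ext1 i
  cases h : x i <;> simp [pointLine, h]

lemma pointLine_some (x : ι → Option α) (hx : ∃ i, x i = none) (a : α) :
    pointLine x hx (some a) = fun i => some (fill a x i) := by
  ext1 i
  cases h : x i <;> simp [pointLine, fill, h]

/-- Extend a subspace by constant coordinates on the right. -/
def extendRight (V : Subspace η α ι) (y : κ → α) : Subspace η α (ι ⊕ κ) where
  idxFun := Sum.elim V.idxFun fun j => Sum.inl (y j)
  proper e := by
    obtain ⟨i, hi⟩ := V.proper e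
    exact ⟨Sum.inl i, by simp [hi]⟩

/-- Extend a subspace by constant coordinates on the left. -/
def extendLeft (x : ι → α) (V : Subspace η α κ) : Subspace η α (ι ⊕ κ) where
  idxFun := Sum.elim (fun j => Sum.inl (x j)) V.idxFun
  proper e := by
    obtain ⟨i, hi⟩ := V.proper e
    exact ⟨Sum.inr i, by simp [hi]⟩

lemma extendRight_apply (V : Subspace η α ι) (y : κ → α) (x : η → α) :
    extendRight V y x = Sum.elim (V x) y := by
  ext i
  cases i <;> simp [extendRight, Subspace.coe_apply]

lemma extendLeft_apply (y : ι → α) (V : Subspace η α κ) (x : η → α) :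
    extendLeft y V x = Sum.elim y (V x) := by
  ext i
  cases i <;> simp [extendLeft, Subspace.coe_apply]

/-- The product of a subspace and a line, the new direction being `none`. -/
def prodLine (V : Subspace η α ι) (l : Line α κ) : Subspace (Option η) α (ι ⊕ κ) where
  idxFun := Sum.elim (fun i => (V.idxFun i).map id some)
    fun j => (l.idxFun j).elim (Sum.inr none) Sum.inl
  proper e := by
    cases e with
    | none =>
      obtain ⟨j, hj⟩ := l.proper
      exact ⟨Sum.inr j, by simp [hj]⟩
    | some e =>
      obtain ⟨i, hi⟩ := V.proper e
      exact ⟨Sum.inl i, by simp [hi]⟩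

lemma prodLine_apply (V : Subspace η α ι) (l : Line α κ) (x : Option η → α) :
    prodLine V l x = Sum.elim (V fun e => x (some e)) (l (x none)) := by
  ext i
  cases i with
  | inl i => cases h : V.idxFun i <;> simp [prodLine, Subspace.coe_apply, h]
  | inr i => cases h : l.idxFun i <;> simp [prodLine, Subspace.coe_apply, h]

lemma liftSub_prodLine_apply (V : Subspace η α ι) (l : Line α κ) (x : Option η → Option α) :
    liftSub (prodLine V l) x =
      Sum.elim (liftSub V fun e => x (some e)) fun j => (l.idxFun j).elim (x none) some := by
  ext1 i
  cases i with
  | inl i => cases h : V.idxFun i <;> simp [prodLine, liftSub, Subspace.coe_apply, h]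
  | inr i => cases h : l.idxFun i <;> simp [prodLine, liftSub, Subspace.coe_apply, h]

end Subspaces

section Ramsey

/-- For every finite colouring of words over `Option α` there is a subspace over `α` on which the
colour of a word depends only on the set of its `none` positions. -/
lemma exists_subspace_color_depends_on_none (α : Type) [Finite α] [Nonempty α]
    (η : Type) [Finite η] : ∀ (κ : Type) [Finite κ], ∃ (ι : Type) (_ : Fintype ι),
      ∀ c : (ι → Option α) → κ, ∃ V : Subspace η α ι, ∀ x x' : η → Option α,
        (∀ e, x e = none ↔ x' e = none) → c (liftSub V x) = c (liftSub V x') := by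
  induction η using Finite.induction_empty_option with
  | of_equiv e ih =>
    intro κ _
    obtain ⟨ι, hι, h⟩ := ih κ
    refine ⟨ι, hι, fun c => ?_⟩
    obtain ⟨V, hV⟩ := h c
    refine ⟨V.reindex e (Equiv.refl _) (Equiv.refl _), fun x x' hx => ?_⟩
    have key : ∀ x, liftSub (V.reindex e (Equiv.refl _) (Equiv.refl _)) x = liftSub V (x ∘ e) := by
      intro x
      ext1 i
      cases h : V.idxFun i <;> simp [liftSub, Subspace.coe_apply, Subspace.reindex, h]
    rw [key, key]
    exact hV _ _ fun j => hx _
  | h_empty =>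
    intro κ _
    exact ⟨Empty, inferInstance, fun c => ⟨⟨fun i => i.elim, fun e => e.elim⟩,
      fun x x' _ => by rw [Subsingleton.elim x x']⟩⟩
  | h_option ih =>
    rename_i η _
    intro κ _
    obtain ⟨ι₀, _, h₀⟩ := ih (κ × κ)
    obtain ⟨ι₁, _, h₁⟩ := Line.exists_mono_in_high_dimension α ((ι₀ → Option α) → κ)
    refine ⟨ι₀ ⊕ ι₁, inferInstance, fun c => ?_⟩
    obtain ⟨l, q, hl⟩ := h₁ fun u p => c (Sum.elim p fun j => some (u j))
    obtain ⟨V, hV⟩ := h₀ fun p => (q p, c (Sum.elim p l.idxFun))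
    have hq : ∀ (p : ι₀ → Option α) (a : α),
        c (Sum.elim p fun j => (l.idxFun j).elim (some a) some) = q p := by
      intro p a
      rw [← congrFun (hl a) p]
      congr 2
      ext1 j
      cases h : l.idxFun j <;> simp [h]
    have hn : (fun j => (l.idxFun j).elim none some) = l.idxFun := by
      ext1 j
      cases h : l.idxFun j <;> simp
    refine ⟨prodLine V l, fun x x' hx => ?_⟩
    rw [liftSub_prodLine_apply, liftSub_prodLine_apply]
    have h := hV (fun e => x (some e)) (fun e => x' (some e)) fun e => hx _
    simp only [Prod.mk.injEq] at h
    cases hx0 : x none with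
    | none =>
      rw [(hx none).1 hx0, hn]
      exact h.2
    | some a =>
      cases hx1 : x' none with
      | none => simp [(hx none).2 hx1] at hx0
      | some b => rw [hq, hq, h.1]

/-- A finite unions theorem in which the colour may depend on the largest index used. -/
lemma exists_blocks_color_depends_on_last (κ : Type) [Finite κ] (m : ℕ) :
    ∃ (ι : Type) (_ : Fintype ι), ∀ c : (ι → Bool) → κ, ∃ g : ι → Option (Fin m),
      (∀ e, ∃ i, g i = some e) ∧ ∃ col : Fin m → κ, ∀ (x : Fin m → Bool) (e : Fin m),
        x e = true → (∀ e', e < e' → x e' = false) →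
          c (fun i => (g i).elim false x) = col e := by
  induction m with
  | zero =>
    exact ⟨Empty, inferInstance, fun c => ⟨fun i => i.elim, fun e => e.elim0, fun e => e.elim0,
      fun x e => e.elim0⟩⟩
  | succ m ih =>
    obtain ⟨ι₀, _, h₀⟩ := ih
    obtain ⟨ι, hι, h⟩ := Subspace.exists_mono_in_high_dimension Bool κ (ι₀ ⊕ Unit)
    refine ⟨ι, hι, fun c => ?_⟩
    obtain ⟨W, q, hW⟩ := h c
    obtain ⟨g, hg, col, hcol⟩ := h₀ fun z => c fun i =>
      (W.idxFun i).elim (fun _ => false) (Sum.elim z fun _ => false)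
    refine ⟨fun i => (W.idxFun i).elim (fun b => if b then some (Fin.last m) else none)
      (Sum.elim (fun j => (g j).map Fin.castSucc) fun _ => some (Fin.last m)), fun e => ?_,
      Fin.snoc col q, fun x e hx hx' => ?_⟩
    · induction e using Fin.lastCases with
      | last =>
        obtain ⟨i, hi⟩ := W.proper (Sum.inr ())
        exact ⟨i, by simp [hi]⟩
      | cast e =>
        obtain ⟨j, hj⟩ := hg e
        obtain ⟨i, hi⟩ := W.proper (Sum.inl j)
        exact ⟨i, by simp [hi, hj]⟩
    · induction e using Fin.lastCases with
      | last =>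
        rw [Fin.snoc_last, ← hW (Sum.elim (fun j => (g j).elim false fun e => x e.castSucc)
          fun _ => true)]
        congr 1
        ext1 i
        rw [Subspace.coe_apply]
        rcases h : W.idxFun i with b | j | u
        · cases b <;> simp [h, hx]
        · cases h' : g j <;> simp [h, h']
        · simp [h, hx]
      | cast e =>
        rw [Fin.snoc_castSucc, ← hcol (fun e => x e.castSucc) e hx
          fun e' he' => hx' _ (by simpa using he')]
        have hl : x (Fin.last m) = false := hx' _ (Fin.castSucc_lt_last e)
        congr 1
        ext1 i
        rcases h : W.idxFun i with b | j | u
        · cases b <;> simp [h, hl]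
        · cases h' : g j <;> simp [h, h']
        · simp [h, hl]

/-- The **finite unions theorem**. -/
lemma exists_blocks_mono (κ : Type) [Finite κ] (η : Type) [Finite η] :
    ∃ (ι : Type) (_ : Fintype ι), ∀ c : (ι → Bool) → κ, ∃ g : ι → Option η,
      (∀ e, ∃ i, g i = some e) ∧ ∃ q : κ, ∀ x : η → Bool, (∃ e, x e = true) →
          c (fun i => (g i).elim false x) = q := by
  classical
  have := Fintype.ofFinite κ
  have := Fintype.ofFinite η
  obtain ⟨ι, hι, h⟩ := exists_blocks_color_depends_on_last κ
    (Fintype.card κ * Fintype.card η)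
  refine ⟨ι, hι, fun c => ?_⟩
  obtain ⟨g, hg, col, hcol⟩ := h c
  have : Nonempty κ := ⟨c fun _ => false⟩
  obtain ⟨q, hq⟩ := Fintype.exists_le_card_fiber_of_mul_le_card col
    (n := Fintype.card η) (by simp)
  obtain ⟨f, hf, hfq⟩ : ∃ f : η → Fin (Fintype.card κ * Fintype.card η),
      Function.Injective f ∧ ∀ e, col (f e) = q := by
    obtain ⟨f⟩ : Nonempty (η ↪ {e // col e = q}) := by
      apply Function.Embedding.nonempty_of_card_le
      rwa [Fintype.card_subtype]
    exact ⟨fun e => f e, Subtype.val_injective.comp f.injective, fun e => (f e).2⟩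
  refine ⟨fun i => (g i).bind (Function.partialInv f), fun e => ?_, q, fun x hx => ?_⟩
  · obtain ⟨i, hi⟩ := hg (f e)
    exact ⟨i, by simp [hi, Function.partialInv_left hf]⟩
  · let y : Fin (Fintype.card κ * Fintype.card η) → Bool :=
      fun e => (Function.partialInv f e).elim false x
    have hne : (univ.filter fun e => y e = true).Nonempty := by
      obtain ⟨e, he⟩ := hx
      exact ⟨f e, by simp [y, Function.partialInv_left hf, he]⟩
    let e₀ := (univ.filter fun e => y e = true).max' hne
    have h₀ : y e₀ = true := by
      have := Finset.max'_mem _ hne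
      simpa using this
    have hmax : ∀ e', e₀ < e' → y e' = false := by
      intro e' he'
      by_contra hne'
      exact absurd (Finset.le_max' (univ.filter fun e => y e = true) e' (by simpa using hne'))
        (not_le.2 he')
    have hcol₀ : col e₀ = q := by
      cases h : Function.partialInv f e₀ with
      | none => simp [y, h] at h₀
      | some j =>
        rw [← (hf.isPartialInv j e₀).1 h]
        exact hfq j
    refine Eq.trans ?_ ((hcol y e₀ h₀ hmax).trans hcol₀)
    congr 1
    ext1 i
    cases h : g i <;> simp [y, h]

/-- The **Graham–Rothschild theorem** for lines. -/
theorem exists_subspace_lines_mono (α : Type) [Finite α] [Nonempty α] (κ : Type) [Finite κ]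
    (η : Type) [Finite η] : ∃ (ι : Type) (_ : Fintype ι),
      ∀ c : (ι → Option α) → κ, ∃ V : Subspace η α ι, ∃ q : κ, ∀ x : η → Option α,
        (∃ e, x e = none) → c (liftSub V x) = q := by
  classical
  obtain ⟨ι₀, _, h₀⟩ := exists_blocks_mono κ η
  obtain ⟨ι, hι, h⟩ := exists_subspace_color_depends_on_none α ι₀ κ
  refine ⟨ι, hι, fun c => ?_⟩
  obtain ⟨V, hV⟩ := h c
  let a₀ : α := Classical.arbitrary α
  obtain ⟨g, hg, q, hq⟩ := h₀ fun z => c (liftSub V fun i => if z i then none else some a₀)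
  let U : Subspace η α ι₀ :=
    ⟨fun i => (g i).elim (Sum.inl a₀) Sum.inr, fun e => by
      obtain ⟨i, hi⟩ := hg e
      exact ⟨i, by simp [hi]⟩⟩
  refine ⟨subComp V U, q, fun x hx => ?_⟩
  have hcomp : liftSub (subComp V U) x = liftSub V (liftSub U x) := by
    ext1 i
    cases h : V.idxFun i <;> simp [liftSub, subComp, Subspace.coe_apply, h]
  obtain ⟨e, he⟩ := hx
  rw [hcomp, ← hq (fun e => (x e).isNone) ⟨e, by simp [he]⟩]
  apply hV
  intro i
  cases h : g i <;> simp [liftSub, Subspace.coe_apply, U, h]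

end Ramsey

section Indicator

variable {X Y : Type}

/-- The real-valued indicator function of a set. -/
noncomputable def ind (S : Set X) (x : X) : ℝ := S.indicator 1 x

lemma ind_of_mem {S : Set X} {x : X} (h : x ∈ S) : ind S x = 1 := by simp [ind, h]

lemma ind_of_notMem {S : Set X} {x : X} (h : x ∉ S) : ind S x = 0 := by simp [ind, h]

lemma ind_nonneg (S : Set X) (x : X) : 0 ≤ ind S x := by
  by_cases h : x ∈ S <;> simp [ind, h]

lemma ind_le_one (S : Set X) (x : X) : ind S x ≤ 1 := by
  by_cases h : x ∈ S <;> simp [ind, h]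

lemma ind_congr {S : Set X} {T : Set Y} {x : X} {y : Y} (h : x ∈ S ↔ y ∈ T) :
    ind S x = ind T y := by
  by_cases hx : x ∈ S
  · rw [ind_of_mem hx, ind_of_mem (h.1 hx)]
  · rw [ind_of_notMem hx, ind_of_notMem (mt h.2 hx)]

end Indicator

section Average

variable {X Y : Type} [Finite X] [Finite Y]

/-- The average of a real function over a finite type. -/
noncomputable def avg (f : X → ℝ) : ℝ :=
  letI := Fintype.ofFinite X
  𝔼 x, f x

lemma avg_eq [Fintype X] (f : X → ℝ) : avg f = (∑ x, f x) / Fintype.card X := by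
  simp only [avg, Fintype.expect_eq_sum_div_card]
  congr!

lemma avg_mono {f g : X → ℝ} (h : ∀ x, f x ≤ g x) : avg f ≤ avg g :=
  letI := Fintype.ofFinite X
  Finset.expect_le_expect fun x _ => h x

lemma avg_add (f g : X → ℝ) : avg (fun x => f x + g x) = avg f + avg g :=
  letI := Fintype.ofFinite X
  Finset.expect_add_distrib _ _ _

lemma avg_sub (f g : X → ℝ) : avg (fun x => f x - g x) = avg f - avg g :=
  letI := Fintype.ofFinite X
  Finset.expect_sub_distrib _ _ _

lemma avg_const_mul (c : ℝ) (f : X → ℝ) : avg (fun x => c * f x) = c * avg f :=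
  letI := Fintype.ofFinite X
  (Finset.mul_expect _ _ _).symm

lemma avg_const [Nonempty X] (c : ℝ) : avg (fun _ : X => c) = c :=
  letI := Fintype.ofFinite X
  Fintype.expect_const c

lemma avg_le [Nonempty X] {f : X → ℝ} {c : ℝ} (h : ∀ x, f x ≤ c) : avg f ≤ c :=
  (avg_mono h).trans_eq (avg_const c)

lemma le_avg [Nonempty X] {f : X → ℝ} {c : ℝ} (h : ∀ x, c ≤ f x) : c ≤ avg f :=
  (avg_const c).symm.trans_le (avg_mono h)

lemma avg_unique [Unique X] (f : X → ℝ) : avg f = f default := by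
  rw [← avg_const (X := X) (f default)]
  congr 1
  ext x
  rw [Unique.eq_default x]

lemma avg_sum {T : Type} (s : Finset T) (f : T → X → ℝ) :
    avg (fun x => ∑ t ∈ s, f t x) = ∑ t ∈ s, avg (f t) :=
  letI := Fintype.ofFinite X
  Finset.expect_sum_comm _ _ _

lemma avg_comm (f : X → Y → ℝ) : avg (fun x => avg (f x)) = avg fun y => avg fun x => f x y :=
  letI := Fintype.ofFinite X
  letI := Fintype.ofFinite Y
  Finset.expect_comm _ _ _

lemma avg_equiv (e : X ≃ Y) (f : Y → ℝ) : avg (fun x => f (e x)) = avg f :=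
  letI := Fintype.ofFinite X
  letI := Fintype.ofFinite Y
  Fintype.expect_equiv e _ _ fun _ => rfl

lemma avg_prod (f : X × Y → ℝ) : avg f = avg fun x => avg fun y => f (x, y) := by
  let := Fintype.ofFinite X
  let := Fintype.ofFinite Y
  rw [avg_eq, avg_eq, Fintype.sum_prod_type, Fintype.card_prod]
  simp_rw [avg_eq]
  rw [← Finset.sum_div, div_div, Nat.cast_mul, mul_comm]

lemma avg_option [Nonempty X] (f : Option X → ℝ) :
    avg f = (1 / (Nat.card X + 1)) * f none +
      (Nat.card X / (Nat.card X + 1)) * avg fun x => f (some x) := by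
  let := Fintype.ofFinite X
  have h : (Fintype.card X : ℝ) ≠ 0 := by simp
  rw [avg_eq, avg_eq, Fintype.sum_option, Fintype.card_option, Nat.card_eq_fintype_card]
  push_cast
  field_simp

variable {α ι κ : Type} [Finite α] [Finite ι] [Finite κ]

lemma avg_sumElim (f : (ι ⊕ κ → α) → ℝ) :
    avg f = avg fun x : ι → α => avg fun y : κ → α => f (Sum.elim x y) := by
  rw [← avg_equiv (Equiv.sumArrowEquivProdArrow ι κ α).symm f, avg_prod]
  rfl

lemma avg_sumElim' (f : (ι ⊕ κ → α) → ℝ) :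
    avg f = avg fun y : κ → α => avg fun x : ι → α => f (Sum.elim x y) := by
  rw [avg_sumElim, avg_comm]

lemma avg_unit (f : (Unit → α) → ℝ) : avg f = avg fun a => f fun _ => a :=
  (avg_equiv (Equiv.funUnique Unit α).symm f).symm

lemma avg_optionElim (f : (Option ι → α) → ℝ) :
    avg f = avg fun x : ι → α => avg fun a : α => f fun o => o.elim a x := by
  rw [← avg_equiv (Equiv.arrowCongr (Equiv.optionEquivSumPUnit.{0} ι).symm (Equiv.refl α)) f,
    avg_sumElim]
  congr 1
  ext x
  rw [avg_unit]
  congr 1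
  ext a
  congr 1
  ext o
  cases o <;> rfl

/-- The density of a set in a finite type. -/
noncomputable def dens (S : Set X) : ℝ := avg (ind S)

lemma dens_nonneg (S : Set X) : 0 ≤ dens S :=
  letI := Fintype.ofFinite X
  Finset.expect_nonneg fun x _ => ind_nonneg S x

lemma dens_le_one [Nonempty X] (S : Set X) : dens S ≤ 1 := avg_le (ind_le_one S)

lemma nonempty_of_dens_pos {S : Set X} (h : 0 < dens S) : S.Nonempty := by
  rw [Set.nonempty_iff_ne_empty]
  rintro rfl
  have : ind (∅ : Set X) = fun _ => 0 := by ext x; simp [ind]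
  rw [dens, this] at h
  simp [avg] at h

/-- A function bounded by `1` with average at least `e` is often at least `e / 2`. -/
lemma half_le_dens [Nonempty X] {f : X → ℝ} {e : ℝ} (he : 0 ≤ e) (hf : ∀ x, f x ≤ 1)
    (h : e ≤ avg f) : e / 2 ≤ dens {x | e / 2 ≤ f x} := by
  have : avg f ≤ dens {x | e / 2 ≤ f x} + e / 2 := by
    rw [dens, ← avg_const (X := X) (e / 2), ← avg_add]
    refine avg_mono fun x => ?_
    rw [avg_const]
    by_cases hx : e / 2 ≤ f x
    · rw [ind_of_mem (by exact hx)]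
      linarith [hf x]
    · rw [ind_of_notMem (by exact hx)]
      linarith
  linarith

/-- The pigeonhole principle for densities. -/
lemma exists_dens_ge {T : Type} [Finite T] {R : T → X → Prop} {S : Set X} {e : ℝ} (he : 0 < e)
    (hS : e ≤ dens S) (h : ∀ x ∈ S, ∃ t, R t x) :
    ∃ t, e / (Nat.card T + 1) ≤ dens {x | R t x} := by
  let := Fintype.ofFinite T
  by_contra! hc
  have h₁ : dens S ≤ ∑ t, dens {x | R t x} := by
    unfold dens
    rw [← avg_sum]
    refine avg_mono fun x => ?_
    by_cases hx : x ∈ S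
    · obtain ⟨t, ht⟩ := h x hx
      rw [ind_of_mem hx, ← ind_of_mem (show x ∈ {x | R t x} from ht)]
      exact Finset.single_le_sum (f := fun t => ind {x | R t x} x)
        (fun t _ => ind_nonneg _ _) (Finset.mem_univ t)
    · rw [ind_of_notMem hx]
      exact Finset.sum_nonneg fun t _ => ind_nonneg _ _
  have h₂ : ∑ t, dens {x | R t x} ≤ ∑ _t : T, e / (Nat.card T + 1) :=
    Finset.sum_le_sum fun t _ => (hc t).le
  rw [Finset.sum_const, Finset.card_univ, ← Nat.card_eq_fintype_card, nsmul_eq_mul] at h₂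
  have h₃ : (Nat.card T : ℝ) * (e / (Nat.card T + 1)) < e := by
    rw [mul_div_assoc', div_lt_iff₀ (by positivity)]
    nlinarith
  linarith

end Average

section Density

instance {α η ι : Type} [Finite α] [Finite η] [Finite ι] : Finite (Subspace η α ι) :=
  Finite.of_injective Subspace.idxFun fun _ _ h => Subspace.ext h

instance {α ι : Type} [Finite α] [Finite ι] : Finite (Line α ι) :=
  Finite.of_injective Line.idxFun fun _ _ h => Line.ext h

/-- Change the index type of the directions of a subspace. -/
def reSub {α η η' ι : Type} (e : η ≃ η') (V : Subspace η α ι) : Subspace η' α ι :=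
  V.reindex e (Equiv.refl _) (Equiv.refl _)

lemma reSub_apply {α η η' ι : Type} (e : η ≃ η') (V : Subspace η α ι) (x : η' → α) :
    reSub e V x = V (x ∘ e) := by
  ext i
  simp [reSub]

/-- The density Hales–Jewett property of the alphabet `α`. -/
def DHJ (α : Type) [Finite α] : Prop :=
  ∀ δ : ℝ, 0 < δ → ∃ (ι : Type) (_ : Finite ι), ∀ D : Set (ι → α), δ ≤ dens D →
    ∃ l : Line α ι, ∀ a, l a ∈ D

variable {α : Type} [Finite α] [Nonempty α]

/-- The multidimensional version of the density Hales–Jewett property. -/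
lemma DHJ.exists_subspace (hα : DHJ α) (η : Type) [Finite η] : ∀ δ : ℝ, 0 < δ →
    ∃ (ι : Type) (_ : Finite ι), ∀ D : Set (ι → α), δ ≤ dens D →
      ∃ V : Subspace η α ι, ∀ x, V x ∈ D := by
  induction η using Finite.induction_empty_option with
  | of_equiv e ih =>
    intro δ hδ
    obtain ⟨ι, hι, h⟩ := ih δ hδ
    refine ⟨ι, hι, fun D hD => ?_⟩
    obtain ⟨V, hV⟩ := h D hD
    exact ⟨reSub e V, fun x => by rw [reSub_apply]; exact hV _⟩
  | h_empty =>
    intro δ hδ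
    refine ⟨Empty, inferInstance, fun D hD => ?_⟩
    obtain ⟨x₀, hx₀⟩ := nonempty_of_dens_pos (hδ.trans_le hD)
    exact ⟨⟨fun i => i.elim, fun e => e.elim⟩, fun x => (Subsingleton.elim x₀ _ ▸ hx₀ :)⟩
  | h_option ih =>
    rename_i η _
    intro δ hδ
    obtain ⟨ι₀, _, h₀⟩ := ih (δ / 2) (by positivity)
    obtain ⟨ι₁, _, h₁⟩ := hα (δ / 2 / (Nat.card (Subspace η α ι₀) + 1)) (by positivity)
    refine ⟨ι₀ ⊕ ι₁, inferInstance, fun D hD => ?_⟩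
    rw [dens, avg_sumElim'] at hD
    have hD' := half_le_dens hδ.le (fun y => avg_le fun x => ind_le_one _ _) hD
    obtain ⟨V, hV⟩ := exists_dens_ge (T := Subspace η α ι₀)
      (R := fun V y => ∀ x, Sum.elim (V x) y ∈ D) (by positivity) hD'
      fun y hy => h₀ {x | Sum.elim x y ∈ D} hy
    obtain ⟨l, hl⟩ := h₁ _ hV
    exact ⟨prodLine V l, fun x => by rw [prodLine_apply]; exact hl _ _⟩

/-- The uniform measure on words over `Option α` is nearly an average of uniform measures
on `α`-lines. -/
lemma exists_line_avg (α : Type) [Finite α] [Nonempty α] {ρ : ℝ} (hρ : 0 < ρ) :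
    ∃ (ι : Type) (_ : Finite ι), ∀ h : (ι → Option α) → ℝ, (∀ x, h x ≤ 1) → ∀ m : ℝ, 0 ≤ m →
      (∀ z : Line (Option α) ι, avg (fun b : α => h (z (some b))) ≤ m) → avg h ≤ ρ + m := by
  set r : ℝ := 1 / (Nat.card α + 1) with hr
  have hr0 : 0 < r := by positivity
  have hα : 0 < Nat.card α := Nat.card_pos
  have hr1 : r < 1 := by
    rw [hr, div_lt_one (by positivity)]
    have : (0 : ℝ) < Nat.card α := by exact_mod_cast hα
    linarith
  have key : ∀ n : ℕ, ∃ (ι : Type) (_ : Finite ι), ∀ h : (ι → Option α) → ℝ, (∀ x, h x ≤ 1) →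
      ∀ m : ℝ, 0 ≤ m → (∀ z : Line (Option α) ι, avg (fun b : α => h (z (some b))) ≤ m) →
        avg h ≤ r ^ n + m := by
    intro n
    induction n with
    | zero =>
      refine ⟨Empty, inferInstance, fun h hh m hm _ => ?_⟩
      have := avg_le hh
      simp only [pow_zero]
      linarith
    | succ n ih =>
      obtain ⟨ι, _, hι⟩ := ih
      refine ⟨Unit ⊕ ι, inferInstance, fun h hh m hm hz => ?_⟩
      rw [avg_sumElim, avg_unit, avg_option, ← hr]
      have h₁ : avg (fun y : ι → Option α => h (Sum.elim (fun _ => none) y)) ≤ r ^ n + m := by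
        refine hι _ (fun _ => hh _) m hm fun z => ?_
        simpa using hz (z.vertical fun _ => none)
      have h₂ : avg (fun b : α => avg fun y : ι → Option α =>
          h (Sum.elim (fun _ => some b) y)) ≤ m := by
        rw [avg_comm]
        refine avg_le fun y => ?_
        have := hz ((Line.diagonal (Option α) Unit).horizontal y)
        simpa using this
      have h₃ : (Nat.card α : ℝ) / (Nat.card α + 1) = 1 - r := by
        rw [hr]
        field_simp
        ring
      rw [h₃]
      have := mul_le_mul_of_nonneg_left h₁ hr0.le
      have := mul_le_mul_of_nonneg_left h₂ (sub_nonneg.2 hr1.le)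
      rw [pow_succ]
      linarith
  obtain ⟨n, hn⟩ := exists_pow_lt_of_lt_one hρ hr1
  obtain ⟨ι, hι, h⟩ := key n
  exact ⟨ι, hι, fun f hf m hm hz => (h f hf m hm hz).trans (by linarith)⟩

/-- The uniform measure on words over `Option α` is nearly an average of uniform measures
on `α`-subspaces. -/
lemma exists_subspace_avg (α : Type) [Finite α] [Nonempty α] (η : Type) [Finite η] :
    ∀ ρ : ℝ, 0 < ρ → ∃ (ι : Type) (_ : Finite ι), ∀ f : (ι → Option α) → ℝ, (∀ x, f x ≤ 1) →
      ∀ m : ℝ, 0 ≤ m → (∀ V : Subspace η (Option α) ι,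
        avg (fun u : η → α => f (V fun e => some (u e))) ≤ m) → avg f ≤ ρ + m := by
  suffices key : ∀ [Finite η] (ρ : ℝ), 0 < ρ → ∃ (ι : Type) (_ : Finite ι),
      ∀ f : (ι → Option α) → ℝ, (∀ x, f x ≤ 1) → ∀ m : ℝ, 0 ≤ m →
        (∀ V : Subspace η (Option α) ι,
          avg (fun u : η → α => f (V fun e => some (u e))) ≤ m) → avg f ≤ ρ + m from key
  induction η using Finite.induction_empty_option with
  | of_equiv e ih =>
    intro _ ρ hρ
    have := Finite.of_equiv _ e.symm
    obtain ⟨ι, hι, h⟩ := ih ρ hρ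
    refine ⟨ι, hι, fun f hf m hm hV => h f hf m hm fun V => ?_⟩
    rw [← avg_equiv (Equiv.arrowCongr e.symm (Equiv.refl α))]
    convert hV (reSub e V) using 4
    rw [reSub_apply]
    rfl
  | h_empty =>
    intro _ ρ hρ
    refine ⟨Empty, inferInstance, fun f hf m hm hV => ?_⟩
    have := hV ⟨fun i => i.elim, fun e => e.elim⟩
    rw [avg_unique] at this ⊢
    have h (x y) (hx : f x ≤ m) : f y ≤ m := Subsingleton.elim x y ▸ hx
    exact (h _ _ this).trans (by linarith)
  | h_option ih =>
    rename_i η _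
    intro _ ρ hρ
    obtain ⟨ι₀, _, h₀⟩ := ih (ρ / 2) (by positivity)
    obtain ⟨ι₁, _, h₁⟩ := exists_line_avg α (ρ := ρ / 2) (by positivity)
    refine ⟨ι₀ ⊕ ι₁, inferInstance, fun f hf m hm hV => ?_⟩
    rw [avg_sumElim']
    have := h₁ (fun y => avg fun x => f (Sum.elim x y)) (fun y => avg_le fun x => hf _)
      (ρ / 2 + m) (by positivity) fun z => by
        rw [avg_comm]
        refine h₀ _ (fun x => avg_le fun b => hf _) m hm fun V => ?_
        have := hV (prodLine V z)
        rw [avg_optionElim] at this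
        simpa only [prodLine_apply, Option.elim_some, Option.elim_none] using this
    linarith

end Density

section Insensitive

variable {α ι κ η : Type}

/-- A set of words over `Option α` is `a`-insensitive if membership does not change when `none`
is replaced by `some a`. -/
def Insens (a : α) (S : Set (ι → Option α)) : Prop :=
  ∀ x, x ∈ S ↔ (fun i => some (fill a x i)) ∈ S

lemma Insens.univ (a : α) : Insens a (Set.univ : Set (ι → Option α)) := fun _ => by simp

lemma Insens.compl {a : α} {S : Set (ι → Option α)} (hS : Insens a S) : Insens a Sᶜ :=
  fun x => not_congr (hS x)

lemma Insens.preimage {a : α} {S : Set (ι → Option α)} (hS : Insens a S)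
    (V : Subspace η (Option α) ι) : Insens a {x | V x ∈ S} := by
  intro x
  have h : fill a (V fun i => some (fill a x i)) = fill a (V x) := by
    ext i
    cases h : V.idxFun i <;> simp [fill, Subspace.coe_apply, h]
  rw [Set.mem_ofPred_eq, Set.mem_ofPred_eq, hS, hS (V _), h]

lemma Insens.sumElim_left {a : α} {S : Set (ι ⊕ κ → Option α)} (hS : Insens a S)
    (x : ι → Option α) : Insens a {y : κ → Option α | Sum.elim x y ∈ S} := by
  intro y
  rw [Set.mem_ofPred_eq, Set.mem_ofPred_eq, hS, hS (Sum.elim x _)]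
  congr! 2 with i
  cases i <;> rfl

lemma Insens.sumElim_right {a : α} {S : Set (ι ⊕ κ → Option α)} (hS : Insens a S)
    (y : κ → Option α) : Insens a {x : ι → Option α | Sum.elim x y ∈ S} := by
  intro x
  rw [Set.mem_ofPred_eq, Set.mem_ofPred_eq, hS, hS (Sum.elim _ y)]
  congr! 2 with i
  cases i <;> rfl

lemma subspace_injective (V : Subspace η α ι) : Function.Injective fun x => V x := by
  intro x x' h
  ext e
  obtain ⟨i, hi⟩ := V.proper e
  simpa [Subspace.coe_apply, hi] using congrFun h i

end Insensitive

section Tiling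

variable {X Y : Type} [Finite X] [Finite Y]

lemma dens_setOf {Z : Type} {g : X → Z} (S : Set Z) : dens {x | g x ∈ S} = avg fun x => ind S (g x) := rfl

lemma avg_ind_range_mul [Nonempty X] {g : X → Y} (hg : Function.Injective g) (f : Y → ℝ) :
    avg (fun y => ind (Set.range g) y * f y) = dens (Set.range g) * avg fun x => f (g x) := by
  classical
  let := Fintype.ofFinite X
  let := Fintype.ofFinite Y
  have key (f : Y → ℝ) : ∑ y, ind (Set.range g) y * f y = ∑ x, f (g x) := by
    rw [← Finset.sum_image (f := f) (g := g) (s := Finset.univ) fun _ _ _ _ h => hg h,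
      ← Finset.sum_subset (Finset.subset_univ (Finset.univ.image g))]
    · refine Finset.sum_congr rfl fun y hy => ?_
      rw [ind_of_mem (by simpa using hy), one_mul]
    · intro y _ hy
      rw [ind_of_notMem (by simpa using hy), zero_mul]
  have h₁ := key fun _ => 1
  simp only [mul_one, Finset.sum_const, Finset.card_univ, nsmul_eq_mul] at h₁
  rw [dens, avg_eq, avg_eq, avg_eq, key, h₁]
  have : (Fintype.card X : ℝ) ≠ 0 := by simp
  field_simp

lemma one_div_card_le_dens {S : Set X} (hS : S.Nonempty) : 1 / (Nat.card X : ℝ) ≤ dens S := by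
  let := Fintype.ofFinite X
  obtain ⟨x, hx⟩ := hS
  rw [dens, avg_eq, Nat.card_eq_fintype_card]
  gcongr
  rw [← ind_of_mem hx]
  exact Finset.single_le_sum (f := ind S) (fun x _ => ind_nonneg S x) (Finset.mem_univ x)

variable {α : Type} [Finite α] [Nonempty α]

/-- Dense insensitive sets contain subspaces of large dimension. -/
lemma DHJ.exists_subspace_insens (hα : DHJ α) (η : Type) [Finite η] {e : ℝ} (he : 0 < e) :
    ∃ (ι : Type) (_ : Finite ι), ∀ (a : α) (S : Set (ι → Option α)), Insens a S → e ≤ dens S →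
      ∃ V : Subspace η (Option α) ι, ∀ x, V x ∈ S := by
  obtain ⟨M, _, hM⟩ := hα.exists_subspace η (e / 4) (by positivity)
  obtain ⟨ι, _, hι⟩ := exists_subspace_avg α M (e / 4) (by positivity)
  refine ⟨ι, inferInstance, fun a S hS hd => ?_⟩
  obtain ⟨V, hV⟩ : ∃ V : Subspace M (Option α) ι,
      e / 4 ≤ avg fun u : M → α => ind S (V fun e => some (u e)) := by
    by_contra! h
    have := hι (ind S) (ind_le_one S) (e / 4) (by positivity) fun V => (h V).le
    rw [dens] at hd
    linarith
  obtain ⟨W, hW⟩ := hM {u | (V fun e => some (u e)) ∈ S} hV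
  refine ⟨subComp V (liftSub W), fun x => ?_⟩
  rw [subComp_apply]
  refine (hS.preimage V _).2 ?_
  rw [fill_liftSub]
  exact hW _

/-- A function with small average on every subspace has small average on every
insensitive set. -/
lemma DHJ.exists_avg_insens_le (hα : DHJ α) (η : Type) [Finite η] {e : ℝ} (he : 0 < e) :
    ∃ (ι : Type) (_ : Finite ι), ∀ (a : α) (S : Set (ι → Option α)), Insens a S →
      ∀ f : (ι → Option α) → ℝ, (∀ x, f x ≤ 1) → ∀ t : ℝ, 0 ≤ t →
        (∀ V : Subspace η (Option α) ι, avg (fun x => f (V x)) ≤ t) →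
          avg (fun x => ind S x * f x) ≤ t + e := by
  obtain ⟨M, _, hM⟩ := hα.exists_subspace_insens η (e := e / 2 / 2) (by positivity)
  set k₀ : ℝ := e / 2 / 2 / (Nat.card (Subspace η (Option α) M) + 1) with hk₀
  set k : ℝ := min (1 / Nat.card (M → Option α) * k₀) (1 / 2) with hk
  have hcard : 0 < Nat.card (M → Option α) := Nat.card_pos
  have hk₀_pos : 0 < k₀ := by positivity
  have hk_pos : 0 < k := by positivity
  have hk_lt : k < 1 := (min_le_right _ _).trans_lt (by norm_num)
  have trivial_bound {ι : Type} [Finite ι] (S : Set (ι → Option α)) (f : (ι → Option α) → ℝ)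
      (hf : ∀ x, f x ≤ 1) : avg (fun x => ind S x * f x) ≤ dens S :=
    avg_mono fun x => mul_le_of_le_one_right (ind_nonneg S x) (hf x)
  have key : ∀ r : ℕ, ∃ (ι : Type) (_ : Finite ι), ∀ (a : α) (S : Set (ι → Option α)),
      Insens a S → ∀ f : (ι → Option α) → ℝ, (∀ x, f x ≤ 1) → ∀ t : ℝ, 0 ≤ t →
        (∀ V : Subspace η (Option α) ι, avg (fun x => f (V x)) ≤ t) →
          avg (fun x => ind S x * f x) ≤ (t + (1 - k) ^ r) * dens S + e / 2 := by
    intro r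
    induction r with
    | zero =>
      refine ⟨Empty, inferInstance, fun a S _ f hf t ht _ => ?_⟩
      have h₁ := trivial_bound S f hf
      have h₂ := mul_nonneg ht (dens_nonneg S)
      rw [pow_zero]
      linarith
    | succ r ih =>
      obtain ⟨ζ, _, hζ⟩ := ih
      refine ⟨M ⊕ ζ, inferInstance, fun a S hS f hf t ht hV => ?_⟩
      set c := (1 - k) ^ r with hc
      have hc0 : 0 < c := pow_pos (by linarith) r
      obtain hd | hd := lt_or_ge (dens S) (e / 2)
      · have h₁ := trivial_bound S f hf
        have h₂ := mul_nonneg (add_nonneg ht (pow_nonneg (sub_nonneg.2 hk_lt.le) (r + 1)))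
          (dens_nonneg S)
        linarith
      rw [dens, avg_sumElim'] at hd
      obtain ⟨V, hB⟩ := exists_dens_ge (T := Subspace η (Option α) M)
        (R := fun V y => ∀ x, Sum.elim (V x) y ∈ S) (by positivity)
        (half_le_dens (by positivity) (fun y => avg_le fun x => ind_le_one _ _) hd)
        fun y hy => hM a {x | Sum.elim x y ∈ S} (hS.sumElim_right y) hy
      set B : Set (ζ → Option α) := {y | ∀ x, Sum.elim (V x) y ∈ S} with hBdef
      set P : Set (M → Option α) := Set.range fun x => V x with hP
      have hB_insens : Insens a B := fun y => forall_congr' fun x => hS.sumElim_left (V x) y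
      set ρ := dens P with hρ
      have h_split (x y) : ind S (Sum.elim x y) =
          ind {y | Sum.elim x y ∈ S ∧ ¬ (x ∈ P ∧ y ∈ B)} y + ind P x * ind B y := by
        by_cases hx : x ∈ P
        · by_cases hy : y ∈ B
          · have hxy : Sum.elim x y ∈ S := by
              obtain ⟨v, rfl⟩ := hx
              exact hy v
            rw [ind_of_mem hxy, ind_of_mem hx, ind_of_mem hy, ind_of_notMem]
            · norm_num
            · exact fun h => h.2 ⟨hx, hy⟩
          · rw [ind_of_notMem hy, mul_zero, add_zero]
            exact ind_congr ⟨fun h => ⟨h, fun h' => hy h'.2⟩, And.left⟩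
        · rw [ind_of_notMem hx, zero_mul, add_zero]
          exact ind_congr ⟨fun h => ⟨h, fun h' => hx h'.1⟩, And.left⟩
      have h_insens (x) : Insens a {y | Sum.elim x y ∈ S ∧ ¬ (x ∈ P ∧ y ∈ B)} := fun y =>
        and_congr (hS.sumElim_left x y) (not_congr (and_congr_right fun _ => hB_insens y))
      have h_dens : dens S = (avg fun x => dens {y | Sum.elim x y ∈ S ∧ ¬ (x ∈ P ∧ y ∈ B)}) +
          ρ * dens B := by
        rw [dens, avg_sumElim]
        simp_rw [h_split, avg_add, avg_const_mul]
        simp_rw [mul_comm _ (avg (ind B)), avg_const_mul]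
        simp only [dens, hρ, mul_comm]
      have h_avg : avg (fun z => ind S z * f z) =
          (avg fun x => avg fun y => ind {y | Sum.elim x y ∈ S ∧ ¬ (x ∈ P ∧ y ∈ B)} y *
            f (Sum.elim x y)) + avg fun y => ind B y * avg fun x => ind P x * f (Sum.elim x y) := by
        rw [avg_sumElim]
        simp_rw [h_split, add_mul, avg_add]
        congr 1
        rw [avg_comm]
        congr 1
        ext y
        rw [← avg_const_mul]
        congr 1
        ext x
        ring
      have h₁ : (avg fun x => avg fun y => ind {y | Sum.elim x y ∈ S ∧ ¬ (x ∈ P ∧ y ∈ B)} y *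
          f (Sum.elim x y)) ≤
          (t + c) * (avg fun x => dens {y | Sum.elim x y ∈ S ∧ ¬ (x ∈ P ∧ y ∈ B)}) + e / 2 := by
        rw [← avg_const_mul, ← avg_const (X := M → Option α) (e / 2), ← avg_add]
        refine avg_mono fun x => ?_
        refine hζ a _ (h_insens x) _ (fun y => hf _) t ht fun W => ?_
        simpa only [extendLeft_apply] using hV (extendLeft x W)
      have h₂ : (avg fun y => ind B y * avg fun x => ind P x * f (Sum.elim x y)) ≤
          t * (ρ * dens B) := by
        rw [dens, ← avg_const_mul, ← avg_const_mul]
        refine avg_mono fun y => ?_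
        rw [hP, avg_ind_range_mul (subspace_injective V), ← hP, ← hρ]
        have := hV (extendRight V y)
        simp only [extendRight_apply] at this
        calc _ ≤ ind B y * (ρ * t) := by
              gcongr
              exacts [ind_nonneg _ _, dens_nonneg _]
          _ = _ := by ring
      have h₃ : k ≤ ρ * dens B := by
        refine (min_le_left _ _).trans ?_
        gcongr
        · exact dens_nonneg _
        · exact one_div_card_le_dens (Set.range_nonempty _)
      have h₄ : k * dens S ≤ k := mul_le_of_le_one_right hk_pos.le (dens_le_one S)
      have h₅ : c * (k * dens S) ≤ c * (ρ * dens B) :=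
        mul_le_mul_of_nonneg_left (h₄.trans h₃) hc0.le
      rw [h_avg, pow_succ, ← hc]
      have h₆ : (avg fun x => dens {y | Sum.elim x y ∈ S ∧ ¬ (x ∈ P ∧ y ∈ B)}) =
        dens S - ρ * dens B := by linarith
      rw [h₆] at h₁
      linarith
  obtain ⟨r, hr⟩ := exists_pow_lt_of_lt_one (half_pos he) (show 1 - k < 1 by linarith)
  obtain ⟨ι, hι, h⟩ := key r
  refine ⟨ι, hι, fun a S hS f hf t ht hV => (h a S hS f hf t ht hV).trans ?_⟩
  have := mul_le_of_le_one_right (add_nonneg ht (pow_nonneg (sub_nonneg.2 hk_lt.le) r))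
    (dens_le_one S)
  linarith

/-- The subspace consisting of all words. -/
def idSub (η α : Type) : Subspace η α η := ⟨Sum.inr, fun e => ⟨e, rfl⟩⟩

lemma idSub_apply {η α : Type} (x : η → α) : idSub η α x = x := by
  ext i
  simp [idSub, Subspace.coe_apply]

/-- A function with nonpositive average on every subspace has small average on the union of
insensitive sets. -/
lemma DHJ.exists_avg_inter_le (hα : DHJ α) (s : Finset α) : ∀ (η : Type) [Finite η] {e : ℝ},
    0 < e → ∃ (ι : Type) (_ : Finite ι), ∀ C : α → Set (ι → Option α), (∀ a, Insens a (C a)) →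
      ∀ f : (ι → Option α) → ℝ, (∀ x, f x ≤ 1) →
        (∀ V : Subspace η (Option α) ι, avg (fun x => f (V x)) ≤ 0) →
          avg f ≤ e ∧ avg (fun x => (1 - ∏ a ∈ s, ind (C a) x) * f x) ≤ e := by
  classical
  induction s using Finset.induction_on with
  | empty =>
    intro η _ e he
    refine ⟨η, inferInstance, fun C _ f _ hV => ⟨?_, ?_⟩⟩
    · have := hV (idSub η (Option α))
      simp only [idSub_apply] at this
      exact this.trans he.le
    · simpa [avg_const] using he.le
  | insert a₀ s ha₀ ih =>
    intro η _ e he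
    obtain ⟨η', _, hη'⟩ := ih η (e := e / 4) (by positivity)
    obtain ⟨ι, _, hι⟩ := hα.exists_avg_insens_le η' (e := e / 4) (by positivity)
    refine ⟨ι, inferInstance, fun C hC f hf hV => ?_⟩
    have h_sub (V : Subspace η' (Option α) ι) := hη' (fun a => {x | V x ∈ C a})
      (fun a => (hC a).preimage V) (fun x => f (V x)) (fun x => hf _) fun W => by
        simpa only [subComp_apply] using hV (subComp V W)
    have h_prod0 (x) : 0 ≤ ∏ a ∈ s, ind (C a) x := Finset.prod_nonneg fun a _ => ind_nonneg _ _
    have h_prod1 (x) : ∏ a ∈ s, ind (C a) x ≤ 1 :=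
      Finset.prod_le_one (fun a _ => ind_nonneg _ _) fun a _ => ind_le_one _ _
    have h₁ := hι a₀ Set.univ (Insens.univ a₀) f hf (e / 4) (by positivity) fun V => (h_sub V).1
    have h₂ := hι a₀ (C a₀)ᶜ (hC a₀).compl f hf (e / 4) (by positivity) fun V => (h_sub V).1
    have h₃ := hι a₀ (C a₀) (hC a₀) (fun x => (1 - ∏ a ∈ s, ind (C a) x) * f x)
      (fun x => by nlinarith [hf x, h_prod0 x, h_prod1 x]) (e / 4) (by positivity)
      fun V => (h_sub V).2
    refine ⟨?_, ?_⟩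
    · simp only [ind_of_mem (Set.mem_univ _), one_mul] at h₁
      linarith
    · have : avg (fun x => (1 - ∏ a ∈ insert a₀ s, ind (C a) x) * f x) =
          avg (fun x => ind (C a₀)ᶜ x * f x) +
            avg fun x => ind (C a₀) x * ((1 - ∏ a ∈ s, ind (C a) x) * f x) := by
        rw [← avg_add]
        congr 1
        ext x
        rw [Finset.prod_insert ha₀]
        by_cases hx : x ∈ C a₀
        · rw [ind_of_mem hx, ind_of_notMem (not_not.2 hx)]
          ring
        · rw [ind_of_notMem hx, ind_of_mem (show x ∈ (C a₀)ᶜ from hx)]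
          ring
      linarith

end Tiling

section DensityHalesJewett

lemma le_card_mul_avg {X : Type} [Finite X] {g : X → ℝ} (hg : ∀ x, 0 ≤ g x) (x : X) :
    g x ≤ Nat.card X * avg g := by
  let := Fintype.ofFinite X
  have : Nonempty X := ⟨x⟩
  have h : (Fintype.card X : ℝ) ≠ 0 := by simp
  rw [avg_eq, Nat.card_eq_fintype_card, mul_div_cancel₀ _ h]
  exact Finset.single_le_sum (fun x _ => hg x) (Finset.mem_univ x)

lemma prod_ind {X α : Type} [Fintype α] (C : α → Set X) (x : X) :
    ∏ a, ind (C a) x = ind {x | ∀ a, x ∈ C a} x := by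
  by_cases hx : ∀ a, x ∈ C a
  · rw [ind_of_mem (by exact hx)]
    exact Finset.prod_eq_one fun a _ => ind_of_mem (hx a)
  · rw [ind_of_notMem (by exact hx)]
    obtain ⟨a, ha⟩ := not_forall.1 hx
    exact Finset.prod_eq_zero (Finset.mem_univ a) (ind_of_notMem ha)

/-- The image of a line under a subspace. -/
def subLine {α η ι : Type} (V : Subspace η α ι) (l : Line α η) : Line α ι where
  idxFun i := (V.idxFun i).elim some l.idxFun
  proper := by
    obtain ⟨j, hj⟩ := l.proper
    obtain ⟨i, hi⟩ := V.proper j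
    exact ⟨i, by simp [hi, hj]⟩

lemma subLine_apply {α η ι : Type} (V : Subspace η α ι) (l : Line α η) (a : α) :
    subLine V l a = V (l a) := by
  ext i
  cases h : V.idxFun i <;> simp [subLine, Subspace.coe_apply, h, Line.coe_apply]

/-- If the density Hales–Jewett property fails, there is a critical density. -/
lemma exists_critical_dens {β : Type} [Finite β] [Nonempty β] (hβ : ¬ DHJ β) : ∃ δ : ℝ, 0 < δ ∧
    (∀ ε : ℝ, 0 < ε → ∃ (ι : Type) (_ : Finite ι), ∀ D : Set (ι → β), δ + ε ≤ dens D →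
      ∃ l : Line β ι, ∀ b, l b ∈ D) ∧
    ∀ ε : ℝ, 0 < ε → ε < δ → ∀ (ι : Type) [Finite ι], ∃ D : Set (ι → β), δ - ε ≤ dens D ∧
      ¬ ∃ l : Line β ι, ∀ b, l b ∈ D := by
  set good : ℝ → Prop := fun d => ∃ (ι : Type) (_ : Finite ι), ∀ D : Set (ι → β), d ≤ dens D →
    ∃ l : Line β ι, ∀ b, l b ∈ D with hgood
  have good_mono {d d' : ℝ} (h : d ≤ d') (hd : good d) : good d' := by
    obtain ⟨ι, hι, hD⟩ := hd
    exact ⟨ι, hι, fun D h' => hD D (h.trans h')⟩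
  obtain ⟨δ₀, hδ₀, hbad⟩ : ∃ δ₀, 0 < δ₀ ∧ ¬ good δ₀ := by
    by_contra! h
    exact hβ h
  have h_two : good 2 := ⟨Empty, inferInstance, fun D hD => by
    have := dens_le_one D
    linarith⟩
  set G : Set ℝ := {d | 0 < d ∧ good d} with hG
  have hG_ne : G.Nonempty := ⟨2, by norm_num, h_two⟩
  have hG_lb : ∀ d ∈ G, δ₀ ≤ d := fun d hd => le_of_lt <| lt_of_not_ge fun h =>
    hbad (good_mono h hd.2)
  refine ⟨sInf G, hδ₀.trans_le (le_csInf hG_ne hG_lb), fun ε hε => ?_, fun ε hε hlt ι _ => ?_⟩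
  · obtain ⟨d, hd, hlt⟩ := exists_lt_of_csInf_lt hG_ne (lt_add_of_pos_right (sInf G) hε)
    exact good_mono hlt.le hd.2
  · by_contra! h
    have : sInf G - ε ∈ G := ⟨sub_pos.2 hlt, ι, inferInstance, fun D hD => by
      simpa using h D hD⟩
    have := csInf_le ⟨δ₀, hG_lb⟩ this
    linarith

/-- The inductive step of the density Hales–Jewett theorem. -/
lemma DHJ.option {α : Type} [Finite α] [Nonempty α] (hα : DHJ α) : DHJ (Option α) := by
  let := Fintype.ofFinite α
  by_contra hfail
  obtain ⟨δ, hδ, hU, hL⟩ := exists_critical_dens hfail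
  obtain ⟨M, _, hM⟩ := hα (δ / 2 / 2) (by positivity)
  set θ : ℝ := δ / 2 / 2 / (Nat.card (Line α M) + 1) with hθ
  have hθ0 : 0 < θ := by positivity
  set γ : ℝ := δ * θ / 4 with hγ
  have hγ0 : 0 < γ := by positivity
  obtain ⟨η, _, hη⟩ := hU γ hγ0
  obtain ⟨ζ, _, hζ⟩ := hα.exists_avg_inter_le Finset.univ η hγ0
  obtain ⟨ι, _, hι⟩ := exists_subspace_lines_mono α Prop (ζ ⊕ M)
  set K : ℝ := (Nat.card (ι → Option α) : ℝ) with hK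
  have hK0 : 0 < K := by
    rw [hK]
    exact_mod_cast Nat.card_pos (α := ι → Option α)
  set τ : ℝ := min (δ / 2) γ with hτ
  have hτ0 : 0 < τ := by positivity
  have hτδ : τ ≤ δ / 2 := min_le_left _ _
  have hτγ : τ ≤ γ := min_le_right _ _
  set ε : ℝ := τ / (2 * K) with hε
  have hε0 : 0 < ε := by positivity
  have hKε : K * (2 * ε) = τ := by
    rw [hε]
    field_simp
  have hK1 : 1 ≤ K := by
    rw [hK]
    exact_mod_cast Nat.card_pos (α := ι → Option α)
  obtain ⟨κ, _, hκ⟩ := hU ε hε0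
  obtain ⟨D, hD, hfree⟩ := hL ε hε0 (by nlinarith) (ι ⊕ κ)
  have h_sec (x : ι → Option α) : δ - τ ≤ dens {y | Sum.elim x y ∈ D} := by
    have h_up (x : ι → Option α) : dens {y | Sum.elim x y ∈ D} ≤ δ + ε := by
      by_contra! h
      obtain ⟨l, hl⟩ := hκ _ h.le
      exact hfree ⟨l.vertical x, fun b => by simpa using hl b⟩
    have h₁ := le_card_mul_avg (g := fun x => δ + ε - dens {y | Sum.elim x y ∈ D})
      (fun x => sub_nonneg.2 (h_up x)) x
    rw [dens, avg_sumElim] at hD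
    rw [avg_sub, avg_const] at h₁
    have h₂ : K * (δ + ε - avg fun x => dens {y | Sum.elim x y ∈ D}) ≤ K * (2 * ε) := by
      refine mul_le_mul_of_nonneg_left ?_ hK0.le
      simp only [dens_setOf]
      linarith
    linarith
  obtain ⟨V, q, hV⟩ := hι fun x =>
    θ ≤ dens {y | ∀ a, Sum.elim (fun i => some (fill a x i)) y ∈ D}
  obtain ⟨a₀⟩ := ‹Nonempty α›
  obtain ⟨⟨i₀⟩, hq⟩ : Nonempty M ∧ q := by
    have h₁ : δ / 2 ≤ avg fun y : κ → Option α => dens {u : M → α |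
        Sum.elim (fun i => some (V (Sum.elim (fun _ => a₀) u) i)) y ∈ D} := by
      simp only [dens_setOf]
      rw [avg_comm]
      refine le_avg fun u => le_trans (by linarith) (h_sec _)
    obtain ⟨l, hl⟩ := exists_dens_ge (T := Line α M)
      (R := fun l y => ∀ a, Sum.elim (fun i => some (V (Sum.elim (fun _ => a₀) (l a)) i)) y ∈ D)
      (by positivity) (half_le_dens (by positivity) (fun y => dens_le_one _) h₁)
      fun y hy => hM _ hy
    refine ⟨l.proper.nonempty, ?_⟩
    rw [← hV (Sum.elim (fun _ => some a₀) l.idxFun)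
      (l.proper.imp' Sum.inr fun i hi => by simpa using hi)]
    refine hl.trans_eq ?_
    congr! 8 with y a
    rw [fill_liftSub]
    congr 2
    ext i
    cases i <;> rfl
  set w : (ζ → Option α) → ι → Option α :=
    fun x => liftSub V (Sum.elim x fun _ => none) with hw
  have h_dens (x : ζ → Option α) :
      θ ≤ dens {y | ∀ a, Sum.elim (fun i => some (fill a (w x) i)) y ∈ D} :=
    (hV (Sum.elim x fun _ => none) ⟨Sum.inr i₀, rfl⟩).mpr hq
  have h_disj (x : ζ → Option α) (y : κ → Option α) (hE : Sum.elim (w x) y ∈ D) :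
      ¬ ∀ a, Sum.elim (fun i => some (fill a (w x) i)) y ∈ D := by
    intro hC
    refine hfree ⟨(pointLine (w x)
      (exists_liftSub_eq_none V ⟨Sum.inr i₀, rfl⟩)).horizontal y, fun b => ?_⟩
    rw [Line.horizontal_apply]
    cases b with
    | none => rwa [pointLine_none]
    | some a =>
      rw [pointLine_some]
      exact hC a
  have h_avg (y : κ → Option α) : (avg fun x => ind D (Sum.elim (w x) y) +
      δ * ind {y | ∀ a, Sum.elim (fun i => some (fill a (w x) i)) y ∈ D} y) ≤ δ + γ + γ := by
    have h := (hζ (fun a => {x | Sum.elim (fun i => some (fill a (w x) i)) y ∈ D})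
      (fun a x => by
        have : fill a (w x) = fill a (w fun i => some (fill a x i)) := by
          rw [hw, fill_liftSub, fill_liftSub]
          congr 1
          ext i
          cases i <;> rfl
        rw [Set.mem_ofPred_eq, Set.mem_ofPred_eq, this])
      (fun x => ind D (Sum.elim (w x) y) - (δ + γ))
      (fun x => by linarith [ind_le_one D (Sum.elim (w x) y)])
      fun W => by
        rw [avg_sub, avg_const, sub_nonpos]
        by_contra! h
        obtain ⟨l, hl⟩ := hη {u | Sum.elim (w (W u)) y ∈ D} h.le
        refine hfree ⟨subLine (extendRight (subComp (liftSub V)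
          (extendRight W fun _ => none)) y) l, fun b => ?_⟩
        rw [subLine_apply, extendRight_apply, subComp_apply, extendRight_apply]
        exact hl b).2
    have h' : (avg fun x => (ind D (Sum.elim (w x) y) +
      δ * ind {y | ∀ a, Sum.elim (fun i => some (fill a (w x) i)) y ∈ D} y) - (δ + γ)) ≤ γ := by
      refine le_trans (avg_mono fun x => ?_) h
      rw [prod_ind]
      by_cases hC : ∀ a, Sum.elim (fun i => some (fill a (w x) i)) y ∈ D
      · rw [ind_of_notMem fun hE => h_disj x y hE hC, ind_of_mem (by exact hC),
          ind_of_mem (by exact hC)]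
        linarith
      · have h₀ : ind {y | ∀ a, Sum.elim (fun i => some (fill a (w x) i)) y ∈ D} y = 0 :=
          ind_of_notMem hC
        have h₁ : ind {x | ∀ a, x ∈ {x | Sum.elim (fun i => some (fill a (w x) i)) y ∈ D}} x = 0 :=
          ind_of_notMem hC
        rw [h₀, h₁]
        linarith
    rw [avg_sub, avg_const] at h'
    linarith
  have h₁ := avg_le h_avg
  rw [avg_comm] at h₁
  have h₂ : δ - τ + δ * θ ≤ avg fun x => avg fun y => ind D (Sum.elim (w x) y) +
      δ * ind {y | ∀ a, Sum.elim (fun i => some (fill a (w x) i)) y ∈ D} y := by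
    refine le_avg fun x => ?_
    rw [avg_add, avg_const_mul]
    exact add_le_add (h_sec (w x)) (mul_le_mul_of_nonneg_left (h_dens x) hδ.le)
  linarith

/-- The **density Hales–Jewett theorem**. -/
theorem densityHalesJewett (α : Type) [Finite α] : DHJ α := by
  suffices key : ∀ [Finite α], DHJ α from key
  induction α using Finite.induction_empty_option with
  | of_equiv e ih =>
    rename_i α β
    intro _ δ hδ
    have := Finite.of_equiv _ e.symm
    obtain ⟨ι, hι, h⟩ := ih δ hδ
    refine ⟨ι, hι, fun D hD => ?_⟩
    rw [dens, ← avg_equiv (Equiv.arrowCongr (Equiv.refl ι) e)] at hD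
    obtain ⟨l, hl⟩ := h {x | (fun i => e (x i)) ∈ D} hD
    refine ⟨l.map e, fun b => ?_⟩
    have := hl (e.symm b)
    rw [Set.mem_ofPred_eq] at this
    convert this using 1
    rw [← e.apply_symm_apply b, Line.map_apply]
    simp
    rfl
  | h_empty =>
    intro _ δ hδ
    exact ⟨Unit, inferInstance, fun D hD => ⟨Line.diagonal _ _, fun b => b.elim⟩⟩
  | h_option ih =>
    rename_i α _
    intro _
    obtain hα | hα := isEmpty_or_nonempty α
    · intro δ hδ
      refine ⟨Unit, inferInstance, fun D hD => ⟨Line.diagonal _ _, fun b => ?_⟩⟩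
      obtain ⟨x, hx⟩ := nonempty_of_dens_pos (hδ.trans_le hD)
      exact (Subsingleton.elim x _ ▸ hx :)
    · exact ih.option

end DensityHalesJewett

section Counting

lemma exists_sum_line_eq {k : ℕ} {ι : Type} [Fintype ι] (l : Line (Fin k) ι) :
    ∃ s w : ℕ, 1 ≤ w ∧ ∀ x, ∑ i, (l x i : ℕ) = s + x * w := by
  refine ⟨∑ i, (l.idxFun i).elim 0 Fin.val, ∑ i, (l.idxFun i).elim 1 fun _ => 0, ?_, fun x => ?_⟩
  · obtain ⟨i, hi⟩ := l.proper
    refine le_trans ?_ (Finset.single_le_sum (fun i _ => Nat.zero_le _) (Finset.mem_univ i))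
    rw [hi]
    rfl
  · rw [Finset.mul_sum, ← Finset.sum_add_distrib]
    refine Finset.sum_congr rfl fun i _ => ?_
    cases h : l.idxFun i <;> simp [Line.coe_apply, h]

lemma card_le_card_filter_shift_add {n s : ℕ} {A : Finset ℕ} (hA : A ⊆ Icc 1 n) :
    A.card ≤ ((Icc 1 n).filter fun a => a + s ∈ A).card + s := by
  classical
  have h : A ⊆ ((Icc 1 n).filter fun a => a + s ∈ A).image (fun a => a + s) ∪ Icc 1 s := by
    intro m hm
    have := Finset.mem_Icc.1 (hA hm)
    simp only [Finset.mem_union, Finset.mem_image, Finset.mem_filter, Finset.mem_Icc]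
    obtain h | h := le_or_gt m s
    · exact Or.inr ⟨this.1, h⟩
    · refine Or.inl ⟨m - s, ⟨by omega, ?_⟩, by omega⟩
      rwa [Nat.sub_add_cancel h.le]
  refine (Finset.card_le_card h).trans ((Finset.card_union_le _ _).trans ?_)
  exact Nat.add_le_add Finset.card_image_le (by simp)

open scoped Classical in
/-- A supersaturated form of **Szemerédi's theorem**. -/
theorem exists_le_card_arithmeticProgressions {k : ℕ} (hk : 2 ≤ k) {δ : ℝ} (hδ : 0 < δ) :
    ∃ ε : ℝ, 0 < ε ∧ ∃ N : ℕ, ∀ n : ℕ, N ≤ n → ∀ A : Finset ℕ, A ⊆ Icc 1 n →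
      δ * n ≤ (A.card : ℝ) → ε * n ^ 2 ≤
        (((Icc 1 n ×ˢ Icc 1 n).filter fun q : ℕ × ℕ => ∀ i < k, q.1 + i * q.2 ∈ A).card : ℝ) := by
  obtain ⟨ι, _, hι⟩ := densityHalesJewett (Fin k) (δ / 4) (by positivity)
  let := Fintype.ofFinite ι
  let := Fintype.ofFinite (Line (Fin k) ι)
  have : NeZero k := ⟨by omega⟩
  set σ : (ι → Fin k) → ℕ := fun x => ∑ i, (x i : ℕ) with hσ
  set L : ℕ := Fintype.card ι * k + 1 with hL
  have hσL (x) : σ x ≤ L := by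
    have : σ x ≤ ∑ _i : ι, k := Finset.sum_le_sum fun i _ => (x i).isLt.le
    simp only [Finset.sum_const, Finset.card_univ, smul_eq_mul] at this
    omega
  have hL0 : (0 : ℝ) < L := by positivity
  set c : ℝ := δ / (2 * L) with hc
  have hc0 : 0 < c := by positivity
  set m : ℝ := Fintype.card (Line (Fin k) ι) + 1 with hm
  have hm0 : 0 < m := by positivity
  choose s w hw hsw using exists_sum_line_eq (k := k) (ι := ι)
  refine ⟨c * δ / 8 / m, by positivity, ⌈2 / c⌉₊, fun n hn A hA hdA => ?_⟩
  set P := (Icc 1 n ×ˢ Icc 1 n).filter fun q : ℕ × ℕ => ∀ i < k, q.1 + i * q.2 ∈ A with hP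
  set H : ℕ := ⌊c * n⌋₊ with hH
  have hn' : 2 / c ≤ n := (Nat.le_ceil _).trans (by exact_mod_cast hn)
  rw [div_le_iff₀ hc0] at hn'
  have hHle : (H : ℝ) ≤ c * n := Nat.floor_le (by positivity)
  have hHge : c * n / 2 ≤ H := by
    have := Nat.lt_floor_add_one (c * n)
    linarith
  set good : ℕ → ℕ → Prop := fun d a => δ / 4 ≤ dens {x | a + d * σ x ∈ A} with hgood
  have h_good (d : ℕ) (hd : d ≤ H) : δ * n / 4 ≤ (((Icc 1 n).filter (good d)).card : ℝ) := by
    have h₁ : δ * n / 2 ≤ ∑ a ∈ Icc 1 n, dens {x | a + d * σ x ∈ A} := by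
      unfold dens
      rw [← avg_sum]
      refine le_avg fun x => ?_
      have h₂ : ∑ a ∈ Icc 1 n, ind {x | a + d * σ x ∈ A} x =
          (((Icc 1 n).filter fun a => a + d * σ x ∈ A).card : ℝ) := by
        rw [Finset.card_filter]
        push_cast
        refine Finset.sum_congr rfl fun a _ => ?_
        split_ifs with h
        · exact ind_of_mem h
        · exact ind_of_notMem h
      have h₃ : (A.card : ℝ) ≤ ((Icc 1 n).filter fun a => a + d * σ x ∈ A).card + d * σ x := by
        exact_mod_cast card_le_card_filter_shift_add hA
      have h₄ : (d : ℝ) * σ x ≤ c * n * L := by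
        gcongr
        · exact le_trans (by exact_mod_cast hd) hHle
        · exact_mod_cast hσL x
      have h₅ : c * n * L = δ * n / 2 := by
        rw [hc]
        field_simp
      rw [h₂]
      linarith
    have h₂ : ∑ a ∈ Icc 1 n, dens {x | a + d * σ x ∈ A} ≤
        ∑ a ∈ Icc 1 n, ((if good d a then 1 else 0) + δ / 4) := by
      refine Finset.sum_le_sum fun a _ => ?_
      split_ifs with h
      · exact (dens_le_one _).trans (by linarith)
      · rw [zero_add]
        exact (not_le.1 h).le
    rw [Finset.sum_add_distrib, Finset.sum_boole, Finset.sum_const, Nat.card_Icc,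
      nsmul_eq_mul, Nat.add_sub_cancel] at h₂
    linarith
  set T := (Icc 1 n ×ˢ Icc 1 H).filter fun q : ℕ × ℕ => good q.2 q.1 with hT
  have hT_ge : c * n / 2 * (δ * n / 4) ≤ (T.card : ℝ) := by
    have : (T.card : ℝ) = ∑ d ∈ Icc 1 H, (((Icc 1 n).filter (good d)).card : ℝ) := by
      rw [hT, Finset.card_filter, Finset.sum_product_right]
      push_cast
      exact Finset.sum_congr rfl fun d _ => by rw [Finset.sum_boole]
    rw [this]
    refine le_trans ?_ (Finset.card_nsmul_le_sum _ _ _ fun d hd => h_good d (Finset.mem_Icc.1 hd).2)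
    rw [Nat.card_Icc, Nat.add_sub_cancel, nsmul_eq_mul]
    gcongr
  have h_line (q : ℕ × ℕ) (hq : q ∈ T) :
      ∃ l : Line (Fin k) ι, (q.1 + q.2 * s l, q.2 * w l) ∈ P := by
    obtain ⟨hq₁, hq₂⟩ := Finset.mem_filter.1 hq
    obtain ⟨l, hl⟩ := hι _ hq₂
    have hA' (i) (hi : i < k) : q.1 + q.2 * s l + i * (q.2 * w l) ∈ A := by
      have := hl ⟨i, hi⟩
      rw [Set.mem_ofPred_eq] at this
      convert this using 1
      simp only [hσ, hsw]
      ring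
    have h₀ := Finset.mem_Icc.1 (hA (hA' 0 (by omega)))
    have h₁ := Finset.mem_Icc.1 (hA (hA' 1 (by omega)))
    have h₂ := (Finset.mem_Icc.1 (Finset.mem_product.1 hq₁).2).1
    have h₃ : 1 ≤ q.2 * w l := Nat.mul_pos h₂ (hw l)
    refine ⟨l, Finset.mem_filter.2 ⟨Finset.mem_product.2
      ⟨Finset.mem_Icc.2 ⟨?_, ?_⟩, Finset.mem_Icc.2 ⟨h₃, ?_⟩⟩, hA'⟩⟩ <;> dsimp only <;> omega
  have h_card : T.card ≤ Fintype.card (Line (Fin k) ι) * P.card := by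
    obtain hT₀ | ⟨q₀, hq₀⟩ := T.eq_empty_or_nonempty
    · simp [hT₀]
    have : Nonempty (Line (Fin k) ι) := ⟨(h_line q₀ hq₀).choose⟩
    choose! l hl using h_line
    rw [← Finset.card_univ, ← Finset.card_product]
    refine Finset.card_le_card_of_injOn (fun q => (l q, (q.1 + q.2 * s (l q), q.2 * w (l q))))
      (fun q hq => Finset.mem_product.2 ⟨Finset.mem_univ _, hl q hq⟩) ?_
    intro q _ q' _ h
    simp only [Prod.mk.injEq] at h
    obtain ⟨h₁, h₂, h₃⟩ := h
    rw [← h₁] at h₂ h₃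
    have h₄ := Nat.eq_of_mul_eq_mul_right (hw (l q)) h₃
    rw [h₄] at h₂
    exact Prod.ext (Nat.add_right_cancel h₂) h₄
  have h_card' : (T.card : ℝ) ≤ m * P.card := by
    have : (T.card : ℝ) ≤ Fintype.card (Line (Fin k) ι) * P.card := by exact_mod_cast h_card
    refine this.trans ?_
    gcongr
    linarith
  rw [div_mul_eq_mul_div, div_le_iff₀ hm0]
  linarith

lemma card_not_rainbow_le {k n : ℕ} {χ : ℕ → ℕ} {A : Finset ℕ} {β : ℝ} (hβ : 0 ≤ β)
    (hA : A ⊆ Icc 1 n) (hχ : BddColoring β A χ) {P : Finset (ℕ × ℕ)}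
    (hP : ∀ q ∈ P, (∀ i < k, q.1 + i * q.2 ∈ A) ∧ ¬ RainbowOn k χ q.1 q.2) :
    (P.card : ℝ) ≤ k ^ 2 * β * n ^ 2 := by
  set S := (A ×ˢ A).filter fun z : ℕ × ℕ => χ z.2 = χ z.1 with hS
  have hAn : (A.card : ℝ) ≤ n := by
    exact_mod_cast (Finset.card_le_card hA).trans_eq (by simp)
  have hS_le : (S.card : ℝ) ≤ β * n ^ 2 := by
    have : (S.card : ℝ) = ∑ x ∈ A, ((A.filter fun y => χ y = χ x).card : ℝ) := by
      rw [hS, Finset.card_filter, Finset.sum_product]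
      push_cast
      exact Finset.sum_congr rfl fun d _ => by rw [Finset.sum_boole]
    rw [this]
    refine (Finset.sum_le_card_nsmul _ _ _ fun x _ => hχ (χ x)).trans ?_
    rw [nsmul_eq_mul]
    calc (A.card : ℝ) * (β * A.card) ≤ n * (β * n) := by gcongr
      _ = β * n ^ 2 := by ring
  have h_pair (q : ℕ × ℕ) (hq : q ∈ P) : ∃ i j : ℕ, i < k ∧ j < k ∧ i ≠ j ∧
      χ (q.1 + i * q.2) = χ (q.1 + j * q.2) := by
    by_contra! h
    exact (hP q hq).2 fun i hi j hj => h i j hi hj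
  choose! f g hf hg hne hfg using h_pair
  have h_card : P.card ≤ k * k * S.card := by
    have : k * k * S.card = ((range k ×ˢ range k) ×ˢ S).card := by simp
    rw [this]
    refine Finset.card_le_card_of_injOn
      (fun q => ((f q, g q), (q.1 + f q * q.2, q.1 + g q * q.2))) (fun q hq => ?_) ?_
    · have := (hP q hq).1
      simp only [Finset.coe_product, Set.mem_prod, Finset.mem_coe, Finset.mem_range, hS,
        Finset.mem_filter, Finset.mem_product]
      exact ⟨⟨hf q hq, hg q hq⟩, ⟨this _ (hf q hq), this _ (hg q hq)⟩, (hfg q hq).symm⟩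
    · intro q hq q' _ h
      simp only [Prod.mk.injEq] at h
      obtain ⟨⟨h₁, h₂⟩, h₃, h₄⟩ := h
      rw [← h₁] at h₃
      rw [← h₂] at h₄
      have h₅ : ((f q : ℤ) - g q) * ((q.2 : ℤ) - q'.2) = 0 := by
        have h₃' : (q.1 : ℤ) + f q * q.2 = q'.1 + f q * q'.2 := by exact_mod_cast h₃
        have h₄' : (q.1 : ℤ) + g q * q.2 = q'.1 + g q * q'.2 := by exact_mod_cast h₄
        linear_combination h₃' - h₄'
      have h₆ : (f q : ℤ) - g q ≠ 0 := sub_ne_zero.2 (by exact_mod_cast hne q hq)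
      have h₇ : q.2 = q'.2 := by
        have := (mul_eq_zero.1 h₅).resolve_left h₆
        omega
      rw [h₇] at h₃
      exact Prod.ext (Nat.add_right_cancel h₃) h₇
  calc (P.card : ℝ) ≤ k * k * S.card := by exact_mod_cast h_card
    _ ≤ k * k * (β * n ^ 2) := by gcongr
    _ = _ := by ring

end Counting

end RainbowAP

open scoped Classical in
theorem rainbow_AP_supersaturation :
    ∀ k : ℕ, 3 ≤ k → ∀ δ : ℝ, 0 < δ → ∃ ε β : ℝ, 0 < ε ∧ 0 < β ∧
      ∃ N : ℕ, ∀ n : ℕ, N ≤ n → ∀ A : Finset ℕ, A ⊆ Finset.Icc 1 n →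
        δ * n ≤ (A.card : ℝ) → ∀ χ : ℕ → ℕ, BddColoring β A χ →
          ε * n ^ 2 ≤
            ((((Finset.Icc 1 n) ×ˢ (Finset.Icc 1 n)).filter fun q : ℕ × ℕ =>
              (∀ i < k, q.1 + i * q.2 ∈ A) ∧ RainbowOn k χ q.1 q.2).card : ℝ) := by
  intro k hk δ hδ
  obtain ⟨ε, hε, N, hN⟩ :=
    RainbowAP.exists_le_card_arithmeticProgressions (k := k) (by omega) hδ
  have hk0 : (0 : ℝ) < k := by exact_mod_cast (by omega : 0 < k)
  refine ⟨ε / 2, ε / (2 * k ^ 2), by positivity, by positivity, N,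
    fun n hn A hA hd χ hχ => ?_⟩
  have h₁ := hN n hn A hA hd
  rw [← Finset.card_filter_add_card_filter_not (fun q : ℕ × ℕ => RainbowOn k χ q.1 q.2),
    Finset.filter_filter] at h₁
  have h₂ := RainbowAP.card_not_rainbow_le (k := k)
    (P := ((Finset.Icc 1 n ×ˢ Finset.Icc 1 n).filter fun q : ℕ × ℕ =>
      ∀ i < k, q.1 + i * q.2 ∈ A).filter fun q => ¬ RainbowOn k χ q.1 q.2)
    (by positivity) hA hχ fun q hq => by
      simp only [Finset.mem_filter] at hq
      exact ⟨hq.1.2, hq.2⟩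
  have h₃ : (k : ℝ) ^ 2 * (ε / (2 * k ^ 2)) * n ^ 2 = ε / 2 * n ^ 2 := by
    field_simp
  rw [h₃] at h₂
  push_cast at h₁
  linarith
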